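/- arXiv:1005.2246 — 2 statements merged into one kernel-verified Lean document; each statement's English description precedes it below -/
import Mathlib

section
/- Let n ≥ 2, let e₀ ∈ ℝ^{n+1} be the first standard basis vector, and let P = {g ∈ SL(n+1,ℝ) : g e₀ = λ e₀ for some λ > 0} be the stabilizer of the ray ℝ₊ e₀. Under the projective action g · x = g x / ‖g x‖ on the unit sphere S^n, the subgroup P has exactly three orbits: the singleton {e₀}, the singleton {−e₀}, and the complement S^n ∖ {e₀, −e₀}. -/
def PRel {n : ℕ} (x y : Fin (n + 1) → ℝ) : Prop :=
  ∃ g : Matrix.SpecialLinearGroup (Fin (n + 1)) ℝ,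
    (g : Matrix (Fin (n + 1)) (Fin (n + 1)) ℝ).mulVec (Pi.single 0 1) = Pi.single 0 1 ∧
    (g : Matrix (Fin (n + 1)) (Fin (n + 1)) ℝ).mulVec x = y

lemma PRel.trans {n : ℕ} {x y z : Fin (n + 1) → ℝ} (h : PRel x y) (k : PRel y z) : PRel x z := by
  obtain ⟨g, h1, h2⟩ := h
  obtain ⟨f, k1, k2⟩ := k
  refine ⟨f * g, ?_, ?_⟩
  · rw [Matrix.SpecialLinearGroup.coe_mul, ← Matrix.mulVec_mulVec, h1, k1]
  · rw [Matrix.SpecialLinearGroup.coe_mul, ← Matrix.mulVec_mulVec, h2, k2]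

lemma PRel.of_form {n : ℕ} {x y : Fin (n + 1) → ℝ} (p : Fin (n + 1) → ℝ) (h0 : p 0 = 0)
    (hx : p ⬝ᵥ x = 1) (hy : p ⬝ᵥ y = 1) : PRel x y := by
  refine ⟨⟨1 + Matrix.vecMulVec (y - x) p, ?_⟩, ?_, ?_⟩
  · rw [Matrix.vecMulVec_eq Unit, Matrix.det_one_add_replicateCol_mul_replicateRow,
      dotProduct_sub, hx, hy]
    simp
  · show (1 + Matrix.vecMulVec (y - x) p).mulVec _ = _
    rw [Matrix.add_mulVec, Matrix.vecMulVec_mulVec, Matrix.one_mulVec, dotProduct_single, h0]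
    simp
  · simp [Matrix.add_mulVec, Matrix.vecMulVec_mulVec, hx]

lemma PRel.coord {n : ℕ} {x : Fin (n + 1) → ℝ} {i j : Fin (n + 1)} (hi : i ≠ 0) (hj : j ≠ 0)
    (hij : i ≠ j) (hx : x i ≠ 0) : PRel x (Pi.single j 1) ∧ PRel (Pi.single j 1) x := by
  have h0 : (Pi.single i ((1 - x j) / x i) + Pi.single j 1 : Fin (n + 1) → ℝ) 0 = 0 := by
    simp [hi.symm, hj.symm]
  have h1 : (Pi.single i ((1 - x j) / x i) + Pi.single j 1 : Fin (n + 1) → ℝ) ⬝ᵥ x = 1 := by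
    simp [add_dotProduct, hx]
  have h2 : (Pi.single i ((1 - x j) / x i) + Pi.single j 1 : Fin (n + 1) → ℝ) ⬝ᵥ
      Pi.single j 1 = 1 := by
    simp [hij.symm]
  exact ⟨PRel.of_form _ h0 h1 h2, PRel.of_form _ h0 h2 h1⟩

lemma PRel.base {n : ℕ} (hn : 2 ≤ n) {x : Fin (n + 1) → ℝ} {i : Fin (n + 1)} (hi : i ≠ 0)
    (hx : x i ≠ 0) {j : Fin (n + 1)} (hj : j ≠ 0) :
    PRel x (Pi.single j 1) ∧ PRel (Pi.single j 1) x := by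
  by_cases hij : i = j
  · obtain ⟨k, hk0, hkj⟩ : ∃ k : Fin (n + 1), k ≠ 0 ∧ k ≠ j := by
      by_cases h1 : j = ⟨1, by omega⟩
      · exact ⟨⟨2, by omega⟩, by simp [Fin.ext_iff], by simp [h1, Fin.ext_iff]⟩
      · exact ⟨⟨1, by omega⟩, by simp [Fin.ext_iff], fun h => h1 h.symm⟩
    have a := PRel.coord hi hk0 (by rw [hij]; exact hkj.symm) hx
    have b := PRel.coord (x := Pi.single k 1) hk0 hj hkj (by simp)
    exact ⟨a.1.trans b.1, b.2.trans a.2⟩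
  · exact PRel.coord hi hj hij hx

lemma eq_of_pos_smul {n : ℕ} {x e : EuclideanSpace ℝ (Fin (n + 1))} (hx : ‖x‖ = 1)
    (he : ‖e‖ = 1) {c : ℝ} (hc : 0 < c) (h : x = c • e) : x = e := by
  have : c = 1 := by
    rw [h, norm_smul, he, Real.norm_of_nonneg hc.le] at hx
    simpa using hx
  rw [h, this, one_smul]

lemma exists_coord {n : ℕ} {x : EuclideanSpace ℝ (Fin (n + 1))} (hx : ‖x‖ = 1)
    (h1 : x ≠ EuclideanSpace.single 0 1) (h2 : x ≠ -EuclideanSpace.single 0 1) :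
    ∃ i : Fin (n + 1), i ≠ 0 ∧ x i ≠ 0 := by
  by_contra! h
  have hx0 : x = EuclideanSpace.single 0 (x 0) := by
    ext i
    by_cases hi : i = 0
    · subst hi; simp
    · simp [hi, h i hi]
  have h3 : |x 0| = 1 := by
    rw [hx0] at hx
    simpa using hx
  rcases eq_or_eq_neg_of_abs_eq h3 with h4 | h4
  · exact h1 (by rw [hx0, h4])
  · apply h2
    rw [hx0, h4]
    ext i
    by_cases hi : i = 0 <;> simp [hi]

lemma fixed_iff {n : ℕ} {x y e : EuclideanSpace ℝ (Fin (n + 1))} (hx : ‖x‖ = 1) (hy : ‖y‖ = 1)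
    (he : ‖e‖ = 1) (g : Matrix.SpecialLinearGroup (Fin (n + 1)) ℝ) {l m : ℝ} (hl : 0 < l)
    (hm : 0 < m)
    (h1 : (g : Matrix (Fin (n + 1)) (Fin (n + 1)) ℝ).mulVec e = l • (e : Fin (n + 1) → ℝ))
    (h2 : (g : Matrix (Fin (n + 1)) (Fin (n + 1)) ℝ).mulVec x = m • (y : Fin (n + 1) → ℝ)) :
    x = e ↔ y = e := by
  constructor
  · rintro rfl
    refine eq_of_pos_smul hy hx (div_pos hl hm) ?_
    ext i
    have := congrFun (h1.symm.trans h2) i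
    simp at this ⊢
    field_simp
    linarith
  · rintro rfl
    refine eq_of_pos_smul hx hy (div_pos hm hl) ?_
    have inj : Function.Injective (g : Matrix (Fin (n + 1)) (Fin (n + 1)) ℝ).mulVec := by
      apply Matrix.mulVec_injective_of_isUnit
      rw [Matrix.isUnit_iff_isUnit_det]
      simp
    have : (x : Fin (n + 1) → ℝ) = (m / l) • (y : Fin (n + 1) → ℝ) := by
      apply inj
      rw [Matrix.mulVec_smul, h1, h2, smul_smul, div_mul_cancel₀ _ hl.ne']
    ext i
    simpa using congrFun this i

/-- Let `n ≥ 2`, `e₀` the first standard basis vector of `ℝ^{n+1}`, and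
`P ⊆ SL(n+1,ℝ)` the stabilizer of the ray `ℝ₊ e₀`. Under the projective action on the
unit sphere `Sⁿ` (where `g` sends the ray of `x` to the ray of `g x`), `P` has exactly
three orbits: `{e₀}`, `{-e₀}` and the complement `Sⁿ \ {e₀, -e₀}`.  This is expressed by
saying that two points `x, y` of the sphere lie in the same `P`-orbit of rays iff they
lie in the same member of this partition. -/
theorem parabolic_orbits_on_sphere (n : ℕ) (hn : 2 ≤ n) :
    ∀ x y : EuclideanSpace ℝ (Fin (n + 1)), ‖x‖ = 1 → ‖y‖ = 1 →
      ((∃ g : Matrix.SpecialLinearGroup (Fin (n + 1)) ℝ,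
        (∃ l : ℝ, 0 < l ∧
          (g : Matrix (Fin (n + 1)) (Fin (n + 1)) ℝ).mulVec
            (EuclideanSpace.single (0 : Fin (n + 1)) (1 : ℝ)) =
            l • (EuclideanSpace.single (0 : Fin (n + 1)) (1 : ℝ) : Fin (n + 1) → ℝ)) ∧
        (∃ m : ℝ, 0 < m ∧
          (g : Matrix (Fin (n + 1)) (Fin (n + 1)) ℝ).mulVec x = m • (y : Fin (n + 1) → ℝ)))
      ↔ ((x = EuclideanSpace.single (0 : Fin (n + 1)) (1 : ℝ) ∧
            y = EuclideanSpace.single (0 : Fin (n + 1)) (1 : ℝ)) ∨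
         (x = -EuclideanSpace.single (0 : Fin (n + 1)) (1 : ℝ) ∧
            y = -EuclideanSpace.single (0 : Fin (n + 1)) (1 : ℝ)) ∨
         (x ≠ EuclideanSpace.single (0 : Fin (n + 1)) (1 : ℝ) ∧
            x ≠ -EuclideanSpace.single (0 : Fin (n + 1)) (1 : ℝ) ∧
            y ≠ EuclideanSpace.single (0 : Fin (n + 1)) (1 : ℝ) ∧
            y ≠ -EuclideanSpace.single (0 : Fin (n + 1)) (1 : ℝ)))) := by
  intro x y hx hy
  have he : ‖(EuclideanSpace.single (0 : Fin (n + 1)) (1 : ℝ))‖ = 1 := by simp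
  constructor
  · rintro ⟨g, ⟨l, hl, h1⟩, m, hm, h2⟩
    have a := fixed_iff hx hy he g hl hm h1 h2
    have b := fixed_iff hx hy (e := -EuclideanSpace.single (0 : Fin (n + 1)) (1 : ℝ))
      (by rw [norm_neg, he]) g hl hm
      (by
        have := congrArg (fun v => -v) h1
        simpa [Matrix.mulVec_neg] using this) h2
    tauto
  · have key : PRel (x : Fin (n + 1) → ℝ) y → _ := fun ⟨g, h1, h2⟩ =>
      (⟨g, ⟨1, one_pos, by simpa using h1⟩, 1, one_pos, by simpa using h2⟩ :
      ∃ g : Matrix.SpecialLinearGroup (Fin (n + 1)) ℝ,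
        (∃ l : ℝ, 0 < l ∧
          (g : Matrix (Fin (n + 1)) (Fin (n + 1)) ℝ).mulVec
            (EuclideanSpace.single (0 : Fin (n + 1)) (1 : ℝ)) =
            l • (EuclideanSpace.single (0 : Fin (n + 1)) (1 : ℝ) : Fin (n + 1) → ℝ)) ∧
        (∃ m : ℝ, 0 < m ∧
          (g : Matrix (Fin (n + 1)) (Fin (n + 1)) ℝ).mulVec x = m • (y : Fin (n + 1) → ℝ)))
    rintro (⟨rfl, rfl⟩ | ⟨rfl, rfl⟩ | ⟨h1, h2, h3, h4⟩)
    · exact key ⟨1, by rw [Matrix.SpecialLinearGroup.coe_one, Matrix.one_mulVec], by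
        rw [Matrix.SpecialLinearGroup.coe_one, Matrix.one_mulVec]⟩
    · exact key ⟨1, by rw [Matrix.SpecialLinearGroup.coe_one, Matrix.one_mulVec], by
        rw [Matrix.SpecialLinearGroup.coe_one, Matrix.one_mulVec]⟩
    · obtain ⟨i, hi, hxi⟩ := exists_coord hx h1 h2
      obtain ⟨j, hj, hyj⟩ := exists_coord hy h3 h4
      exact key ((PRel.base hn hi hxi hi).1.trans (PRel.base hn hj hyj hi).2)
end

section
/- Let r, s ≥ 1 with r + s = n + 1 ≥ 3, and let Q = Q_{r,s} be the standard quadratic form of signature (r,s) on ℝ^{n+1}. Let H = {g ∈ SL(n+1,ℝ) : Q(g x) = Q(x) for all x}. Then under the projective action g · x = g x/‖g x‖ on the unit sphere S^n, the group H has exactly three orbits: {x ∈ S^n : Q(x) > 0}, {x ∈ S^n : Q(x) = 0}, and {x ∈ S^n : Q(x) < 0}. -/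
section Aux
variable {ι : Type*} [Fintype ι]

/-- diagonal bilinear form -/
def bilF (e x y : ι → ℝ) : ℝ := ∑ i, e i * x i * y i


lemma bilF_add_left (e x y z : ι → ℝ) : bilF e (x + y) z = bilF e x z + bilF e y z := by
  simp only [bilF, ← Finset.sum_add_distrib, Pi.add_apply]
  exact Finset.sum_congr rfl fun i _ => by ring


lemma bilF_smul_left (e x z : ι → ℝ) (c : ℝ) : bilF e (c • x) z = c * bilF e x z := by
  simp only [bilF, Finset.mul_sum, Pi.smul_apply, smul_eq_mul]
  exact Finset.sum_congr rfl fun i _ => by ring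


lemma bilF_comm (e x z : ι → ℝ) : bilF e x z = bilF e z x := by
  simp only [bilF]
  exact Finset.sum_congr rfl fun i _ => by ring


lemma bilF_add_right (e x y z : ι → ℝ) : bilF e z (x + y) = bilF e z x + bilF e z y := by
  rw [bilF_comm, bilF_add_left, bilF_comm e x, bilF_comm e y]


lemma bilF_smul_right (e x z : ι → ℝ) (c : ℝ) : bilF e z (c • x) = c * bilF e z x := by
  rw [bilF_comm, bilF_smul_left, bilF_comm e x]


lemma bilF_sub_left (e x y z : ι → ℝ) : bilF e (x - y) z = bilF e x z - bilF e y z := by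
  rw [sub_eq_add_neg, ← neg_one_smul ℝ y, bilF_add_left, bilF_smul_left]; ring


lemma bilF_sub_right (e x y z : ι → ℝ) : bilF e z (x - y) = bilF e z x - bilF e z y := by
  rw [bilF_comm, bilF_sub_left, bilF_comm e x, bilF_comm e y]

variable [DecidableEq ι]

/-- isometries of the form -/
def IsoF (e : ι → ℝ) (A : Matrix ι ι ℝ) : Prop := ∀ v, bilF e (A.mulVec v) (A.mulVec v) = bilF e v v

/-- existence of a reflection -/
lemma exists_refl (e z : ι → ℝ) (hz : bilF e z z ≠ 0) :
    ∃ A : Matrix ι ι ℝ, IsoF e A ∧ A.det = -1 ∧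
      ∀ v, A.mulVec v = v - (2 * bilF e v z / bilF e z z) • z := by
  have hA : ∀ v, (1 + Matrix.vecMulVec ((-2 / bilF e z z) • z) (e * z)).mulVec v
      = v - (2 * bilF e v z / bilF e z z) • z := by
    intro v
    have : (e * z) ⬝ᵥ v = bilF e v z := by
      simp only [bilF, dotProduct, Pi.mul_apply]
      exact Finset.sum_congr rfl fun i _ => by ring
    rw [Matrix.add_mulVec, Matrix.one_mulVec, Matrix.vecMulVec_mulVec, this]
    ext i
    simp
    ring
  refine ⟨_, ?_, ?_, hA⟩
  · intro v
    rw [hA]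
    simp only [bilF_sub_left, bilF_sub_right, bilF_smul_left, bilF_smul_right, bilF_comm e z v]
    field_simp
    ring
  · rw [Matrix.vecMulVec_eq Unit, Matrix.det_one_add_replicateCol_mul_replicateRow]
    have : (e * z) ⬝ᵥ z = bilF e z z := by
      simp only [bilF, dotProduct, Pi.mul_apply]
    rw [dotProduct_smul, this, smul_eq_mul]
    field_simp
    norm_num

/-- related by an isometry of determinant plus or minus one -/
def RelF (e x y : ι → ℝ) : Prop :=
  ∃ A : Matrix ι ι ℝ, IsoF e A ∧ (A.det = 1 ∨ A.det = -1) ∧ A.mulVec x = y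

lemma RelF.trans {e x y z : ι → ℝ} (h : RelF e x y) (h' : RelF e y z) : RelF e x z := by
  obtain ⟨A, hA, dA, rfl⟩ := h
  obtain ⟨C, hC, dC, rfl⟩ := h'
  refine ⟨C * A, ?_, ?_, ?_⟩
  · intro v; rw [← Matrix.mulVec_mulVec, hC, hA]
  · rw [Matrix.det_mul]; rcases dA with h | h <;> rcases dC with h' | h' <;> simp [h, h']
  · rw [Matrix.mulVec_mulVec]

lemma rel_of_sub {e x y : ι → ℝ} (h : bilF e x x = bilF e y y)
    (hz : bilF e (x - y) (x - y) ≠ 0) : RelF e x y := by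
  obtain ⟨A, hA, dA, h1⟩ := exists_refl e _ hz
  refine ⟨A, hA, Or.inr dA, ?_⟩
  rw [h1]
  have : 2 * bilF e x (x - y) / bilF e (x - y) (x - y) = 1 := by
    rw [div_eq_one_iff_eq hz]
    simp only [bilF_sub_left, bilF_sub_right, bilF_comm e y x]
    linarith
  rw [this]; simp

lemma rel_nonnull {e x y : ι → ℝ} (h : bilF e x x = bilF e y y) (h0 : bilF e y y ≠ 0) :
    RelF e x y := by
  by_cases hz : bilF e (x - y) (x - y) = 0
  · have h2 : RelF e x (-y) := by
      apply rel_of_sub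
      · rw [h, ← neg_one_smul ℝ y, bilF_smul_left, bilF_smul_right]; ring
      · simp only [bilF_sub_left, bilF_sub_right, bilF_comm e y x] at hz
        rw [sub_neg_eq_add]
        simp only [bilF_add_left, bilF_add_right, bilF_comm e y x]
        intro h3; apply h0; linarith
    refine h2.trans (rel_of_sub ?_ ?_)
    · rw [← neg_one_smul ℝ y, bilF_smul_left, bilF_smul_right]; ring
    · have : -y - y = (-2 : ℝ) • y := by ext i; simp; ring
      rw [this, bilF_smul_left, bilF_smul_right]
      simpa using h0
  · exact rel_of_sub h hz

lemma rel_null_step {e x y : ι → ℝ} (h : bilF e x x = 0) (h' : bilF e y y = 0)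
    (h0 : bilF e x y ≠ 0) : RelF e x y := by
  apply rel_of_sub (by rw [h, h'])
  simp only [bilF_sub_left, bilF_sub_right, bilF_comm e y x, h, h']
  intro h3; apply h0; linarith

lemma rel_null {e x y : ι → ℝ} (he : ∀ i, e i * e i = 1) (h : bilF e x x = 0)
    (h' : bilF e y y = 0) (hx : x ⬝ᵥ x = 1) (hy : y ⬝ᵥ y = 1) : RelF e x y := by
  have hJ : ∀ u v, bilF e u (e * v) = u ⬝ᵥ v := by
    intro u v
    simp only [bilF, dotProduct, Pi.mul_apply]
    exact Finset.sum_congr rfl fun i _ => by linear_combination (u i * v i) * he i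
  have hJJ : ∀ u v, bilF e (e * u) (e * v) = bilF e u v := by
    intro u v
    simp only [bilF, Pi.mul_apply]
    exact Finset.sum_congr rfl fun i _ => by linear_combination (e i * u i * v i) * he i
  by_cases h0 : bilF e x y = 0
  · by_cases hd : x ⬝ᵥ y = 0
    · have hw : bilF e (e * (x + y)) (e * (x + y)) = 0 := by
        rw [hJJ]
        simp only [bilF_add_left, bilF_add_right, bilF_comm e y x, h, h', h0]; simp
      refine (rel_null_step (y := e * (x + y)) h hw ?_).trans (rel_null_step hw h' ?_)
      · rw [hJ, dotProduct_add, hx, hd]; norm_num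
      · rw [bilF_comm, hJ, dotProduct_add, hy, dotProduct_comm, hd]; norm_num
    · have hw : bilF e (e * x) (e * x) = 0 := by rw [hJJ, h]
      refine (rel_null_step (y := e * x) h hw ?_).trans (rel_null_step hw h' ?_)
      · rw [hJ, hx]; norm_num
      · rw [bilF_comm, hJ, dotProduct_comm]; exact hd
  · exact rel_null_step h h' h0

lemma exists_perp {e : ι → ℝ} (he : ∀ i, e i * e i = 1) {i j : ι} (hij : i ≠ j) (hh : e i = e j)
    (y : ι → ℝ) : ∃ z, bilF e y z = 0 ∧ bilF e z z ≠ 0 := by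
  have hs : ∀ u k c, bilF e u (Pi.single k c) = e k * u k * c := by
    intro u k c
    simp [bilF, Pi.single_apply]
  have hne : e j ≠ 0 := by intro h; simpa [h] using he j
  by_cases h : y i = 0 ∧ y j = 0
  · refine ⟨Pi.single i 1, ?_, ?_⟩
    · rw [hs, h.1]; ring
    · rw [hs, hh]; simpa using hne
  · refine ⟨Pi.single i (y j) - Pi.single j (y i), ?_, ?_⟩
    · rw [bilF_sub_right, hs, hs, hh]; ring
    · rw [bilF_sub_right, hs, hs, hh]
      simp only [Pi.sub_apply, Pi.single_eq_same, Pi.single_eq_of_ne hij,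
        Pi.single_eq_of_ne hij.symm]
      intro h3
      apply h
      have : y i ^ 2 + y j ^ 2 = 0 := by
        apply mul_left_cancel₀ hne; linear_combination h3
      constructor <;> nlinarith [sq_nonneg (y i), sq_nonneg (y j)]

lemma RelF.special {e x y : ι → ℝ} (he : ∀ i, e i * e i = 1) {i j : ι} (hij : i ≠ j)
    (hh : e i = e j) (h : RelF e x y) :
    ∃ g : Matrix.SpecialLinearGroup ι ℝ, IsoF e (g : Matrix ι ι ℝ) ∧
      (g : Matrix ι ι ℝ).mulVec x = y := by
  obtain ⟨A, hA, dA, rfl⟩ := h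
  rcases dA with d | d
  · exact ⟨⟨A, d⟩, hA, rfl⟩
  · obtain ⟨z, h1, h2⟩ := exists_perp he hij hh (A.mulVec x)
    obtain ⟨C, hC, dC, h3⟩ := exists_refl e z h2
    refine ⟨⟨C * A, by rw [Matrix.det_mul, d, dC]; norm_num⟩, ?_, ?_⟩
    · intro v
      change bilF e ((C * A).mulVec v) ((C * A).mulVec v) = _
      rw [← Matrix.mulVec_mulVec, hC, hA]
    · change (C * A).mulVec x = _
      rw [← Matrix.mulVec_mulVec, h3, h1]; simp

lemma exists_ratio {e x y : ι → ℝ} (h : 0 < bilF e x x / bilF e y y) :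
    ∃ m : ℝ, 0 < m ∧ RelF e x (m • y) := by
  have h0 : bilF e y y ≠ 0 := by rintro h'; simp [h'] at h
  have hm := Real.sqrt_pos.2 h
  have hq : bilF e x x = bilF e (√(bilF e x x / bilF e y y) • y) (√(bilF e x x / bilF e y y) • y) := by
    rw [bilF_smul_left, bilF_smul_right, ← mul_assoc, Real.mul_self_sqrt h.le]
    field_simp
  refine ⟨_, hm, rel_nonnull hq ?_⟩
  rw [← hq]; rintro h'; simp [h'] at h

end Aux


/-- Let `r, s ≥ 1` with `r + s = n + 1 ≥ 3`, `Q = Q_{r,s}` the standard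
quadratic form of signature `(r,s)` on `ℝ^{n+1}`, and `H = {g ∈ SL(n+1,ℝ) : Q ∘ g = Q}`.
Under the projective action on the unit sphere, `H` has exactly three orbits:
`{Q > 0}`, `{Q = 0}` and `{Q < 0}` on `Sⁿ`: each is nonempty on the sphere, and two
sphere points lie in the same `H`-orbit of rays iff `Q` has the same sign at both. -/
theorem indefinite_orthogonal_orbits_on_sphere (r s : ℕ) (hr : 1 ≤ r) (hs : 1 ≤ s)
    (hn : 3 ≤ r + s) :
    letI Q : (Fin (r + s) → ℝ) → ℝ :=
      fun x => ∑ i : Fin (r + s), if (i : ℕ) < r then x i ^ 2 else -(x i ^ 2)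
    ((∃ x : EuclideanSpace ℝ (Fin (r + s)), ‖x‖ = 1 ∧ 0 < Q x) ∧
     (∃ x : EuclideanSpace ℝ (Fin (r + s)), ‖x‖ = 1 ∧ Q x = 0) ∧
     (∃ x : EuclideanSpace ℝ (Fin (r + s)), ‖x‖ = 1 ∧ Q x < 0)) ∧
    ∀ x y : EuclideanSpace ℝ (Fin (r + s)), ‖x‖ = 1 → ‖y‖ = 1 →
      ((∃ g : Matrix.SpecialLinearGroup (Fin (r + s)) ℝ,
        (∀ v : Fin (r + s) → ℝ,
          Q ((g : Matrix (Fin (r + s)) (Fin (r + s)) ℝ).mulVec v) = Q v) ∧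
        (∃ m : ℝ, 0 < m ∧
          (g : Matrix (Fin (r + s)) (Fin (r + s)) ℝ).mulVec x = m • (y : Fin (r + s) → ℝ)))
      ↔ ((0 < Q x ∧ 0 < Q y) ∨ (Q x = 0 ∧ Q y = 0) ∨ (Q x < 0 ∧ Q y < 0))) := by
  set Q : (Fin (r + s) → ℝ) → ℝ :=
    fun x => ∑ i : Fin (r + s), if (i : ℕ) < r then x i ^ 2 else -(x i ^ 2) with hQdef
  set e : Fin (r + s) → ℝ := fun i => if (i : ℕ) < r then 1 else -1 with hedef
  have he : ∀ i, e i * e i = 1 := by intro i; simp only [hedef]; split_ifs <;> norm_num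
  have hQ : ∀ v, Q v = bilF e v v := by
    intro v
    simp only [Q, bilF, hedef]
    exact Finset.sum_congr rfl fun i _ => by split_ifs <;> ring
  have hs' : ∀ u k c, bilF e u (Pi.single k c) = e k * u k * c := by
    intro u k c
    simp [bilF, Pi.single_apply]
  have hdot : ∀ x : EuclideanSpace ℝ (Fin (r + s)), ‖x‖ = 1 → x.ofLp ⬝ᵥ x.ofLp = 1 := by
    intro x hx
    have := EuclideanSpace.real_norm_sq_eq x
    rw [hx] at this
    simp only [dotProduct]
    rw [← one_pow 2, this]
    exact Finset.sum_congr rfl fun i _ => by ring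
  obtain ⟨i, j, hij, hh⟩ : ∃ i j : Fin (r + s), i ≠ j ∧ e i = e j := by
    by_cases h2 : 2 ≤ r
    · refine ⟨⟨0, by omega⟩, ⟨1, by omega⟩, by simp, ?_⟩
      simp only [hedef]
      rw [if_pos (by omega), if_pos (by omega)]
    · refine ⟨⟨r, by omega⟩, ⟨r + 1, by omega⟩, by simp, ?_⟩
      simp only [hedef]
      rw [if_neg (by omega), if_neg (by omega)]
  have hnorm : ∀ v : Fin (r + s) → ℝ, v ≠ 0 → ∃ x : EuclideanSpace ℝ (Fin (r + s)), ‖x‖ = 1 ∧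
      ∃ c : ℝ, 0 < c ∧ Q x = c * bilF e v v := by
    intro v hv
    have hv' : (WithLp.toLp 2 v : EuclideanSpace ℝ (Fin (r + s))) ≠ 0 := by
      intro h; apply hv; simpa using h
    have hp := norm_pos_iff.2 hv'
    refine ⟨‖(WithLp.toLp 2 v : EuclideanSpace ℝ (Fin (r + s)))‖⁻¹ • WithLp.toLp 2 v,
      norm_smul_inv_norm hv', _, mul_pos (inv_pos.2 hp) (inv_pos.2 hp), ?_⟩
    rw [hQ, WithLp.ofLp_smul, bilF_smul_left, bilF_smul_right, mul_assoc]
  have e0 : e ⟨0, by omega⟩ = 1 := by simp only [hedef]; rw [if_pos (by omega)]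
  have er : e ⟨r, by omega⟩ = -1 := by simp only [hedef]; rw [if_neg (by omega)]
  have h0r : (⟨0, by omega⟩ : Fin (r + s)) ≠ ⟨r, by omega⟩ := by
    simp; omega
  refine ⟨⟨?_, ?_, ?_⟩, ?_⟩
  · obtain ⟨x, hx, c, hc, h⟩ := hnorm (Pi.single ⟨0, by omega⟩ 1) (by simp)
    refine ⟨x, hx, ?_⟩
    rw [h, hs', e0]; simpa using hc
  · obtain ⟨x, hx, c, hc, h⟩ := hnorm (Pi.single ⟨0, by omega⟩ 1 + Pi.single ⟨r, by omega⟩ 1) (by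
      intro h
      have := congrFun h ⟨0, by omega⟩
      simp [Pi.single_eq_of_ne h0r] at this)
    refine ⟨x, hx, ?_⟩
    rw [h, bilF_add_right, hs', hs', e0, er]
    simp [Pi.single_eq_of_ne h0r, Pi.single_eq_of_ne h0r.symm]
  · obtain ⟨x, hx, c, hc, h⟩ := hnorm (Pi.single ⟨r, by omega⟩ 1) (by simp)
    refine ⟨x, hx, ?_⟩
    rw [h, hs', er]; simpa using hc
  · intro x y hx hy
    constructor
    · rintro ⟨g, hg, m, hm, hgx⟩
      have h1 := hg x
      rw [hgx, hQ (m • y.ofLp), bilF_smul_left, bilF_smul_right, ← mul_assoc, ← hQ] at h1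
      have hmm := mul_pos hm hm
      rw [← h1]
      rcases lt_trichotomy (Q y) 0 with h | h | h
      · exact Or.inr (Or.inr ⟨mul_neg_of_pos_of_neg hmm h, h⟩)
      · exact Or.inr (Or.inl ⟨by rw [h, mul_zero], h⟩)
      · exact Or.inl ⟨mul_pos hmm h, h⟩
    · intro h
      have key : ∃ m : ℝ, 0 < m ∧ RelF e x.ofLp (m • y.ofLp) := by
        simp only [hQ] at h
        rcases h with ⟨h1, h2⟩ | ⟨h1, h2⟩ | ⟨h1, h2⟩
        · exact exists_ratio (div_pos h1 h2)
        · exact ⟨1, one_pos, by rw [one_smul]; exact rel_null he h1 h2 (hdot x hx) (hdot y hy)⟩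
        · exact exists_ratio (div_pos_of_neg_of_neg h1 h2)
      obtain ⟨m, hm, hrel⟩ := key
      obtain ⟨g, hg, hgx⟩ := hrel.special he hij hh
      exact ⟨g, fun v => by rw [hQ, hQ]; exact hg v, m, hm, hgx⟩
end
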